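/- arXiv:2009.07178 — 4 statements merged into one kernel-verified Lean document; each statement's English description precedes it below -/
import Mathlib

section
/- Let ℓ, u be reals with 0 ≤ ℓ < u and let n ≥ 2 be an integer. The point (ξ_1, …, ξ_{n−1}) with ξ_i = ℓ + (i/n)·(u−ℓ) for i = 1, …, n−1 is the unique minimizer of the volume function V_2 over the domain D, and the minimum value is V_2 = (u−ℓ)³/18 + (u−ℓ)³/(36·n²). -/
/-- The full sequence of linearization points: `ξ 0 = ℓ`, `ξ n = u`,
interior coordinates given by `x`. -/
noncomputable def xiSeq (l u : ℝ) (n : ℕ) (x : Fin (n - 1) → ℝ) (i : ℕ) : ℝ :=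
  if h : 0 < i ∧ i < n then x ⟨i - 1, by omega⟩ else if i = 0 then l else u

/-- The open domain `D = {ℓ < ξ₁ < ⋯ < ξ_{n-1} < u}`. -/
def domD (l u : ℝ) (n : ℕ) : Set (Fin (n - 1) → ℝ) :=
  {x | ∀ i < n, xiSeq l u n x i < xiSeq l u n x (i + 1)}

/-- The volume function `V_p` of the perspective relaxation of the piecewise-linear
under-estimator of `x^p` with linearization points `ℓ = ξ₀ < ξ₁ < ⋯ < ξ_n = u`. -/
noncomputable def Vp (l u p : ℝ) (n : ℕ) (x : Fin (n - 1) → ℝ) : ℝ :=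
  -((p - 1) ^ 2 / (6 * p)) * ∑ i ∈ Finset.Icc 1 n,
      (xiSeq l u n x (i - 1)) ^ (p - 1) * (xiSeq l u n x i) ^ (p - 1)
        * (xiSeq l u n x i - xiSeq l u n x (i - 1)) ^ 2
        / ((xiSeq l u n x i) ^ (p - 1) - (xiSeq l u n x (i - 1)) ^ (p - 1))
  + ((p - 1) / (6 * p)) * (u ^ (p + 1) - l ^ (p + 1)) - (1 / 6) * (u ^ p * l - u * l ^ p)

lemma sum_Icc_shift_aux (f : ℕ → ℝ) (n : ℕ) :
    ∑ i ∈ Finset.Icc 1 n, f i = ∑ i ∈ Finset.range n, f (i + 1) := by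
  induction n with
  | zero => simp
  | succ k ih => rw [Finset.sum_Icc_succ_top (by omega), ih, Finset.sum_range_succ]

lemma xiSeq_zero' (l u : ℝ) (n : ℕ) (x : Fin (n - 1) → ℝ) : xiSeq l u n x 0 = l := by
  simp [xiSeq]

lemma xiSeq_last' (l u : ℝ) (n : ℕ) (hn : 2 ≤ n) (x : Fin (n - 1) → ℝ) :
    xiSeq l u n x n = u := by
  have : n ≠ 0 := by omega
  simp [xiSeq, this]

lemma xiSeq_eq_aux (l u : ℝ) (n : ℕ) (hn : 2 ≤ n) (i : ℕ) (hi : i ≤ n) :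
    xiSeq l u n (fun i : Fin (n - 1) => l + (((i : ℕ) + 1 : ℝ) / n) * (u - l)) i
      = l + i * ((u - l) / n) := by
  have hn0 : (n : ℝ) ≠ 0 := by
    have : n ≠ 0 := by omega
    exact_mod_cast this
  rcases Nat.eq_zero_or_pos i with h0 | h0
  · subst h0
    simp [xiSeq_zero']
  rcases Nat.lt_or_ge i n with h1 | h1
  · have h2 : 0 < i ∧ i < n := ⟨h0, h1⟩
    unfold xiSeq
    rw [dif_pos h2]
    have : ((i - 1 : ℕ) : ℝ) + 1 = i := by
      have : i - 1 + 1 = i := by omega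
      exact_mod_cast this
    simp only [this]
    ring
  · have : i = n := by omega
    subst this
    rw [xiSeq_last' l u i hn]
    field_simp
    ring

lemma Vp_two_aux (l u : ℝ) (n : ℕ) (hn : 2 ≤ n) (x : Fin (n - 1) → ℝ)
    (hx : x ∈ domD l u n) :
    Vp l u 2 n x = (u - l) ^ 3 / 18 +
      (1 / 36) * ∑ i ∈ Finset.range n, (xiSeq l u n x (i + 1) - xiSeq l u n x i) ^ 3 := by
  have hx' : ∀ i < n, xiSeq l u n x i < xiSeq l u n x (i + 1) := hx
  have e1 : (2 : ℝ) - 1 = 1 := by norm_num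
  have e2 : (2 : ℝ) + 1 = ((3 : ℕ) : ℝ) := by norm_num
  have e3 : (2 : ℝ) = ((2 : ℕ) : ℝ) := by norm_num
  have hu2 : ∀ a : ℝ, a ^ (2 : ℝ) = a ^ 2 := fun a => by
    rw [e3, Real.rpow_natCast]
  have hu3 : ∀ a : ℝ, a ^ ((2 : ℝ) + 1) = a ^ 3 := fun a => by
    rw [e2, Real.rpow_natCast]
  have hT := Finset.sum_range_sub (fun i => (xiSeq l u n x i) ^ 3) n
  simp only [xiSeq_zero', xiSeq_last' l u n hn] at hT
  unfold Vp
  rw [hu3, hu3, hu2, hu2]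
  have hS : ∑ i ∈ Finset.range n,
      (xiSeq l u n x (i + 1 - 1)) ^ ((2 : ℝ) - 1) * (xiSeq l u n x (i + 1)) ^ ((2 : ℝ) - 1)
        * (xiSeq l u n x (i + 1) - xiSeq l u n x (i + 1 - 1)) ^ 2
        / ((xiSeq l u n x (i + 1)) ^ ((2 : ℝ) - 1) - (xiSeq l u n x (i + 1 - 1)) ^ ((2 : ℝ) - 1))
      = ∑ i ∈ Finset.range n, ((1 / 3) * (xiSeq l u n x (i + 1) ^ 3 - xiSeq l u n x i ^ 3)
        - (1 / 3) * (xiSeq l u n x (i + 1) - xiSeq l u n x i) ^ 3) := by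
    apply Finset.sum_congr rfl
    intro i hi
    have h := hx' i (Finset.mem_range.mp hi)
    have h' : xiSeq l u n x (i + 1) - xiSeq l u n x i ≠ 0 := (sub_pos.mpr h).ne'
    simp only [e1, Real.rpow_one, Nat.add_sub_cancel]
    rw [div_eq_iff h']
    ring
  rw [sum_Icc_shift_aux, hS, Finset.sum_sub_distrib, ← Finset.mul_sum, ← Finset.mul_sum, hT]
  ring

/-- Theorem: the equally-spaced points `ξᵢ = ℓ + (i/n)(u-ℓ)` form the unique minimizer of
`V_2` on `D`, with minimum value `(u-ℓ)³/18 + (u-ℓ)³/(36 n²)`. -/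
theorem equally_spaced_unique_minimizer_quadratic
    (l u : ℝ) (hl : 0 ≤ l) (hlu : l < u) (n : ℕ) (hn : 2 ≤ n) :
    (fun i : Fin (n - 1) => l + (((i : ℕ) + 1 : ℝ) / n) * (u - l)) ∈ domD l u n ∧
    Vp l u 2 n (fun i : Fin (n - 1) => l + (((i : ℕ) + 1 : ℝ) / n) * (u - l))
      = (u - l) ^ 3 / 18 + (u - l) ^ 3 / (36 * n ^ 2) ∧
    ∀ x ∈ domD l u n,
      x ≠ (fun i : Fin (n - 1) => l + (((i : ℕ) + 1 : ℝ) / n) * (u - l)) →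
      Vp l u 2 n (fun i : Fin (n - 1) => l + (((i : ℕ) + 1 : ℝ) / n) * (u - l))
        < Vp l u 2 n x := by
  have hnp : (0 : ℝ) < n := by
    have : 0 < n := by omega
    exact_mod_cast this
  obtain ⟨h, hh⟩ : ∃ h, h = (u - l) / n := ⟨_, rfl⟩
  have hpos : 0 < h := by rw [hh]; exact div_pos (sub_pos.mpr hlu) hnp
  have hul : u - l = n * h := by rw [hh]; field_simp
  have hxi := xiSeq_eq_aux l u n hn
  rw [← hh] at hxi
  have hmem : (fun i : Fin (n - 1) => l + (((i : ℕ) + 1 : ℝ) / n) * (u - l)) ∈ domD l u n := by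
    intro i hi
    rw [hxi i hi.le, hxi (i + 1) hi]
    push_cast
    linarith
  have hval : Vp l u 2 n (fun i : Fin (n - 1) => l + (((i : ℕ) + 1 : ℝ) / n) * (u - l))
      = (u - l) ^ 3 / 18 + (1 / 36) * (n * h ^ 3) := by
    rw [Vp_two_aux l u n hn _ hmem]
    have : ∀ i ∈ Finset.range n,
        (xiSeq l u n (fun i : Fin (n - 1) => l + (((i : ℕ) + 1 : ℝ) / n) * (u - l)) (i + 1)
        - xiSeq l u n (fun i : Fin (n - 1) => l + (((i : ℕ) + 1 : ℝ) / n) * (u - l)) i) ^ 3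
        = h ^ 3 := by
      intro i hi
      have hi := Finset.mem_range.mp hi
      rw [hxi i hi.le, hxi (i + 1) hi]
      push_cast
      ring
    rw [Finset.sum_congr rfl this]
    simp
  refine ⟨hmem, ?_, ?_⟩
  · rw [hval, hul]
    field_simp
  · intro x hx hne
    have hx' : ∀ i < n, xiSeq l u n x i < xiSeq l u n x (i + 1) := hx
    rw [hval, Vp_two_aux l u n hn x hx]
    have hT := Finset.sum_range_sub (fun i => xiSeq l u n x i) n
    simp only [xiSeq_zero', xiSeq_last' l u n hn] at hT
    have hL : ∑ i ∈ Finset.range n,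
        (3 * h ^ 2 * (xiSeq l u n x (i + 1) - xiSeq l u n x i) - 2 * h ^ 3) = n * h ^ 3 := by
      rw [Finset.sum_sub_distrib, ← Finset.mul_sum, hT, hul]
      simp
      ring
    have key : ∃ i ∈ Finset.range n, xiSeq l u n x (i + 1) - xiSeq l u n x i ≠ h := by
      by_contra hcon
      push Not at hcon
      apply hne
      have hs : ∀ i ≤ n, xiSeq l u n x i = l + i * h := by
        intro i
        induction i with
        | zero => intro _; simp [xiSeq_zero']
        | succ k ih =>
          intro hk
          have h1 := hcon k (Finset.mem_range.mpr hk)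
          have h2 := ih (by omega)
          push_cast
          linarith
      funext j
      have hj := j.isLt
      have h1 := hs (j + 1) (by omega)
      have h2 : 0 < (j : ℕ) + 1 ∧ (j : ℕ) + 1 < n := by omega
      unfold xiSeq at h1
      rw [dif_pos h2] at h1
      simp only [Nat.add_sub_cancel, Fin.eta] at h1
      rw [h1, hh]
      push_cast
      ring
    have hid : ∀ d : ℝ, d ^ 3 - (3 * h ^ 2 * d - 2 * h ^ 3) = (d - h) ^ 2 * (d + 2 * h) := by
      intro d; ring
    have hlt : (n : ℝ) * h ^ 3
        < ∑ i ∈ Finset.range n, (xiSeq l u n x (i + 1) - xiSeq l u n x i) ^ 3 := by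
      rw [← hL]
      apply Finset.sum_lt_sum
      · intro i hi
        have h1 := hx' i (Finset.mem_range.mp hi)
        have h2 : 0 < (xiSeq l u n x (i + 1) - xiSeq l u n x i) + 2 * h := by linarith
        have h3 := mul_nonneg (sq_nonneg (xiSeq l u n x (i + 1) - xiSeq l u n x i - h)) h2.le
        rw [← hid] at h3
        linarith
      · obtain ⟨i, hi, hne'⟩ := key
        refine ⟨i, hi, ?_⟩
        have h1 := hx' i (Finset.mem_range.mp hi)
        have h2 : 0 < (xiSeq l u n x (i + 1) - xiSeq l u n x i) + 2 * h := by linarith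
        have h3 := mul_pos (sq_pos_of_ne_zero (sub_ne_zero.mpr hne')) h2
        rw [← hid] at h3
        linarith
    linarith
end

section
/- For reals ℓ, u with 0 ≤ ℓ < u, the three-dimensional Lebesgue measure of the set {(x, y, z) ∈ ℝ³ : 0 < z ≤ 1, ℓ·z ≤ x ≤ u·z, x²/z ≤ y ≤ (ℓ+u)·x − ℓ·u·z} equals (u−ℓ)³/18. -/
open MeasureTheory in
lemma slice_aux (l u z : ℝ) (hlu : l < u) (hz : 0 < z) :
    volume {p : ℝ × ℝ | l * z ≤ p.1 ∧ p.1 ≤ u * z ∧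
      p.1 ^ 2 / z ≤ p.2 ∧ p.2 ≤ (l + u) * p.1 - l * u * z}
      = ENNReal.ofReal ((u - l) ^ 3 / 6 * z ^ 2) := by
  have hm : MeasurableSet {p : ℝ × ℝ | l * z ≤ p.1 ∧ p.1 ≤ u * z ∧
      p.1 ^ 2 / z ≤ p.2 ∧ p.2 ≤ (l + u) * p.1 - l * u * z} := by
    measurability
  have hle : l * z ≤ u * z := by nlinarith
  rw [Measure.volume_eq_prod, Measure.prod_apply hm]
  have h1 : ∀ x : ℝ, volume (Prod.mk x ⁻¹' {p : ℝ × ℝ | l * z ≤ p.1 ∧ p.1 ≤ u * z ∧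
      p.1 ^ 2 / z ≤ p.2 ∧ p.2 ≤ (l + u) * p.1 - l * u * z}) =
      (Set.Icc (l * z) (u * z)).indicator
        (fun x => ENNReal.ofReal ((l + u) * x - l * u * z - x ^ 2 / z)) x := by
    intro x
    by_cases hx : x ∈ Set.Icc (l * z) (u * z)
    · rw [Set.indicator_of_mem hx, ← Real.volume_Icc]
      congr 1
      ext y
      simp [hx.1, hx.2]
    · rw [Set.indicator_of_notMem hx]
      convert measure_empty (μ := (volume : Measure ℝ))
      ext y
      simp only [Set.mem_preimage, Set.mem_setOf_eq, Set.mem_empty_iff_false, iff_false]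
      exact fun h => hx ⟨h.1, h.2.1⟩
  simp_rw [h1]
  rw [lintegral_indicator measurableSet_Icc, ← ofReal_integral_eq_lintegral_ofReal]
  · congr 1
    rw [integral_Icc_eq_integral_Ioc, ← intervalIntegral.integral_of_le hle]
    rw [intervalIntegral.integral_sub, intervalIntegral.integral_sub,
      intervalIntegral.integral_const_mul, intervalIntegral.integral_div]
    · simp only [integral_id, integral_pow, intervalIntegral.integral_const, smul_eq_mul]
      field_simp
      push_cast
      ring
    all_goals apply Continuous.intervalIntegrable; fun_prop
  · apply Continuous.integrableOn_Icc
    fun_prop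
  · rw [Filter.EventuallyLE, ae_restrict_iff' measurableSet_Icc]
    refine Filter.Eventually.of_forall fun x hx => ?_
    have : (l + u) * x - l * u * z - x ^ 2 / z = (x - l * z) * (u * z - x) / z := by
      field_simp
      ring
    simp only [Pi.zero_apply]
    rw [this]
    exact div_nonneg (mul_nonneg (sub_nonneg.2 hx.1) (sub_nonneg.2 hx.2)) hz.le

/-- The 3-dimensional Lebesgue measure of the perspective relaxation of `x²` on `[ℓ,u]`
equals `(u-ℓ)³/18`. -/
theorem volume_perspective_relaxation_quadratic (l u : ℝ) (hl : 0 ≤ l) (hlu : l < u) :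
    MeasureTheory.volume {v : ℝ × ℝ × ℝ |
      0 < v.2.2 ∧ v.2.2 ≤ 1 ∧ l * v.2.2 ≤ v.1 ∧ v.1 ≤ u * v.2.2 ∧
      v.1 ^ 2 / v.2.2 ≤ v.2.1 ∧ v.2.1 ≤ (l + u) * v.1 - l * u * v.2.2}
      = ENNReal.ofReal ((u - l) ^ 3 / 18) := by
  open MeasureTheory in
  set S := {v : ℝ × ℝ × ℝ |
      0 < v.2.2 ∧ v.2.2 ≤ 1 ∧ l * v.2.2 ≤ v.1 ∧ v.1 ≤ u * v.2.2 ∧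
      v.1 ^ 2 / v.2.2 ≤ v.2.1 ∧ v.2.1 ≤ (l + u) * v.1 - l * u * v.2.2} with hS
  have hm : MeasurableSet S := by
    rw [hS]
    measurability
  have hp := volume_preserving_prodAssoc (α₁ := ℝ) (β₁ := ℝ) (γ₁ := ℝ)
  rw [← hp.measure_preimage_equiv S, Measure.volume_eq_prod,
    Measure.prod_apply_symm (MeasurableEquiv.prodAssoc.measurable hm)]
  have h1 : ∀ z : ℝ, volume ((fun p : ℝ × ℝ => (p, z)) ⁻¹'
      ((MeasurableEquiv.prodAssoc : (ℝ × ℝ) × ℝ ≃ᵐ ℝ × ℝ × ℝ) ⁻¹' S)) =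
      (Set.Ioc (0:ℝ) 1).indicator
        (fun z => ENNReal.ofReal ((u - l) ^ 3 / 6 * z ^ 2)) z := by
    intro z
    by_cases hz : z ∈ Set.Ioc (0:ℝ) 1
    · rw [Set.indicator_of_mem hz, ← slice_aux l u z hlu hz.1]
      congr 1
      ext p
      simp [hS, MeasurableEquiv.prodAssoc, hz.1, hz.2]
    · rw [Set.indicator_of_notMem hz]
      convert measure_empty (μ := (volume : Measure (ℝ × ℝ)))
      ext p
      simp only [Set.mem_preimage, Set.mem_empty_iff_false, iff_false]
      exact fun h => hz ⟨h.1, h.2.1⟩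
  simp_rw [h1]
  have h0 : 0 ≤ (u - l) ^ 3 := pow_nonneg (sub_nonneg.2 hlu.le) 3
  rw [lintegral_indicator measurableSet_Ioc, ← ofReal_integral_eq_lintegral_ofReal]
  · congr 1
    rw [← intervalIntegral.integral_of_le zero_le_one, intervalIntegral.integral_const_mul,
      integral_pow]
    norm_num
    ring
  · apply Continuous.integrableOn_Ioc
    fun_prop
  · exact Filter.Eventually.of_forall fun z => by
      simp only [Pi.zero_apply]
      positivity
end

section
/- Let ℓ, u be reals with 0 ≤ ℓ < u, let n ≥ 2 be an integer, let p > 1, and let ξ ∈ D. Let J(ξ) denote the (n−1)×(n−1) Jacobian matrix of the map F at ξ. If either (i) 1 < p < 2 and F_i(ξ) ≥ 0 for all i = 1, …, n−1, or (ii) p > 2, then J(ξ) is invertible and every entry of J(ξ)^{−1} is nonnegative. -/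
/-- The stationarity map `F = (F_1, …, F_{n-1})`: here the coordinate `j : Fin (n-1)`
corresponds to the index `i = j + 1 ∈ {1, …, n-1}` of the paper. -/
noncomputable def Fmap (l u p : ℝ) (n : ℕ) (x : Fin (n - 1) → ℝ) (j : Fin (n - 1)) : ℝ :=
  -((xiSeq l u n x ((j : ℕ) + 1)) ^ p + (p - 1) * (xiSeq l u n x ((j : ℕ) + 2)) ^ p
      - p * (xiSeq l u n x ((j : ℕ) + 1)) * (xiSeq l u n x ((j : ℕ) + 2)) ^ (p - 1))
    / ((xiSeq l u n x ((j : ℕ) + 2)) ^ (p - 1) - (xiSeq l u n x ((j : ℕ) + 1)) ^ (p - 1))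
  + ((xiSeq l u n x ((j : ℕ) + 1)) ^ p + (p - 1) * (xiSeq l u n x (j : ℕ)) ^ p
      - p * (xiSeq l u n x ((j : ℕ) + 1)) * (xiSeq l u n x (j : ℕ)) ^ (p - 1))
    / ((xiSeq l u n x ((j : ℕ) + 1)) ^ (p - 1) - (xiSeq l u n x (j : ℕ)) ^ (p - 1))

/-- The Jacobian matrix `J(ξ) = [∂F_i/∂ξ_j]` of the map `F` at `x`. -/
noncomputable def Jmat (l u p : ℝ) (n : ℕ) (x : Fin (n - 1) → ℝ) :
    Matrix (Fin (n - 1)) (Fin (n - 1)) ℝ :=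
  Matrix.of fun i j => fderiv ℝ (fun y => Fmap l u p n y i) x (Pi.single j 1)

/-- Centre of mass of `s ^ (p-2)` on `[a,b]`. -/
noncomputable def tt (p a b : ℝ) : ℝ := ((b ^ p - a ^ p) / p) / ((b ^ (p-1) - a ^ (p-1)) / (p-1))

noncomputable def al (p a b : ℝ) : ℝ :=
  a ^ (p-2) * (tt p a b - a) / ((b ^ (p-1) - a ^ (p-1)) / (p-1))

noncomputable def be (p a b : ℝ) : ℝ :=
  b ^ (p-2) * (b - tt p a b) / ((b ^ (p-1) - a ^ (p-1)) / (p-1))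

lemma M0_pos {p a b : ℝ} (hp : 1 < p) (ha : 0 ≤ a) (hab : a < b) :
    0 < (b ^ (p-1) - a ^ (p-1)) / (p-1) := by
  have := Real.rpow_lt_rpow ha hab (show 0 < p - 1 by linarith)
  exact div_pos (by linarith) (by linarith)

lemma g_deriv {p c s : ℝ} (hp : 1 < p) (hs : 0 < s) :
    HasDerivAt (fun s : ℝ => s ^ p / p - c * (s ^ (p-1) / (p-1))) (s ^ (p-2) * (s - c)) s := by
  have h1 := (Real.hasDerivAt_rpow_const (x := s) (p := p) (Or.inl hs.ne')).div_const p
  have h2 := ((Real.hasDerivAt_rpow_const (x := s) (p := p-1) (Or.inl hs.ne')).div_const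
    (p-1)).const_mul c
  refine (h1.sub h2).congr_deriv ?_
  have e : s ^ (p-1) = s ^ (p-2) * s := by
    rw [← Real.rpow_add_one hs.ne']; ring_nf
  have e2 : p - 1 - 1 = p - 2 := by ring
  rw [e2, e]
  have : p ≠ 0 := by linarith
  have : p - 1 ≠ 0 := by linarith
  field_simp

lemma g_cont {p c : ℝ} (hp : 1 < p) (S : Set ℝ) :
    ContinuousOn (fun s : ℝ => s ^ p / p - c * (s ^ (p-1) / (p-1))) S := by
  have h1 := Real.continuous_rpow_const (q := p) (by linarith)
  have h2 := Real.continuous_rpow_const (q := p - 1) (by linarith)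
  exact ((h1.div_const p).sub ((h2.div_const (p-1)).const_mul c)).continuousOn

lemma lt_tt {p a b : ℝ} (hp : 1 < p) (ha : 0 ≤ a) (hab : a < b) : a < tt p a b := by
  have h : StrictMonoOn (fun s : ℝ => s ^ p / p - a * (s ^ (p-1) / (p-1))) (Set.Icc a b) := by
    apply strictMonoOn_of_deriv_pos (convex_Icc a b) (g_cont hp _)
    intro s hs
    rw [interior_Icc] at hs
    have h0 : 0 < s := ha.trans_lt hs.1
    rw [(g_deriv hp h0).deriv]
    exact mul_pos (Real.rpow_pos_of_pos h0 _) (by linarith [hs.1])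
  have := h (Set.left_mem_Icc.2 hab.le) (Set.right_mem_Icc.2 hab.le) hab
  rw [tt, lt_div_iff₀ (M0_pos hp ha hab), sub_div, sub_div]
  simp only at this
  linarith

lemma tt_lt {p a b : ℝ} (hp : 1 < p) (ha : 0 ≤ a) (hab : a < b) : tt p a b < b := by
  have h : StrictAntiOn (fun s : ℝ => s ^ p / p - b * (s ^ (p-1) / (p-1))) (Set.Icc a b) := by
    apply strictAntiOn_of_deriv_neg (convex_Icc a b) (g_cont hp _)
    intro s hs
    rw [interior_Icc] at hs
    have h0 : 0 < s := ha.trans_lt hs.1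
    rw [(g_deriv hp h0).deriv]
    exact mul_neg_of_pos_of_neg (Real.rpow_pos_of_pos h0 _) (by linarith [hs.2])
  have := h (Set.left_mem_Icc.2 hab.le) (Set.right_mem_Icc.2 hab.le) hab
  rw [tt, div_lt_iff₀ (M0_pos hp ha hab), sub_div, sub_div]
  simp only at this
  linarith

lemma al_nonneg {p a b : ℝ} (hp : 1 < p) (ha : 0 ≤ a) (hab : a < b) : 0 ≤ al p a b :=
  div_nonneg (mul_nonneg (Real.rpow_nonneg ha _) (by linarith [lt_tt hp ha hab]))
    (M0_pos hp ha hab).le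

lemma be_pos {p a b : ℝ} (hp : 1 < p) (ha : 0 ≤ a) (hab : a < b) : 0 < be p a b :=
  div_pos (mul_pos (Real.rpow_pos_of_pos (ha.trans_lt hab) _) (by linarith [tt_lt hp ha hab]))
    (M0_pos hp ha hab)

lemma rp1 {p a : ℝ} (hp : 1 < p) (ha : 0 ≤ a) : a * a ^ (p-2) = a ^ (p-1) := by
  rcases ha.eq_or_lt with rfl | h
  · rw [Real.zero_rpow (by linarith : p - 1 ≠ 0)]; simp
  · rw [mul_comm, ← Real.rpow_add_one h.ne']; ring_nf

lemma rp0 {p a : ℝ} (hp : 1 < p) (ha : 0 ≤ a) : a * a ^ (p-1) = a ^ p := by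
  rcases ha.eq_or_lt with rfl | h
  · rw [Real.zero_rpow (by linarith : p ≠ 0)]; simp
  · rw [mul_comm, ← Real.rpow_add_one h.ne']; ring_nf

lemma euler {p a b : ℝ} (hp : 1 < p) (ha : 0 ≤ a) (hab : a < b) :
    a * al p a b + b * be p a b = tt p a b := by
  have hM := M0_pos hp ha hab
  have h1 := rp1 hp ha
  have h2 := rp1 hp (ha.trans hab.le)
  have h3 := rp0 hp ha
  have h4 := rp0 hp (ha.trans hab.le)
  have hT : tt p a b * ((b ^ (p-1) - a ^ (p-1)) / (p-1)) = (b ^ p - a ^ p) / p := by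
    rw [tt]; exact div_mul_cancel₀ _ hM.ne'
  rw [al, be, ← mul_div_assoc, ← mul_div_assoc, ← add_div, div_eq_iff hM.ne', hT,
    ← mul_assoc, ← mul_assoc, h1, h2]
  have hp0 : p ≠ 0 := by linarith
  have hp1 : p - 1 ≠ 0 := by linarith
  have hT2 : tt p a b * (b ^ (p-1) - a ^ (p-1)) = (p-1) * ((b ^ p - a ^ p) / p) := by
    rw [← hT]; field_simp
  have : (b ^ p - a ^ p) = p * ((b ^ p - a ^ p) / p) := by field_simp
  linear_combination this - hT2 - h3 + h4

lemma sum_le_one {p a b : ℝ} (hp : 2 < p) (ha : 0 ≤ a) (hab : a < b) :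
    al p a b + be p a b ≤ 1 := by
  have hp' : 1 < p := by linarith
  have hM := M0_pos hp' ha hab
  have h1 := rp1 hp' ha
  have h2 := rp1 hp' (ha.trans hab.le)
  have hp0 : p ≠ 0 := by linarith
  have hp1 : p - 1 ≠ 0 := by linarith
  have hp2 : p - 2 ≠ 0 := by linarith
  have hK : 0 < (b ^ (p-2) - a ^ (p-2)) / (p-2) := by
    have := Real.rpow_lt_rpow ha hab (show 0 < p - 2 by linarith)
    exact div_pos (by linarith) (by linarith)
  have hq : ∀ t : ℝ, 0 ≤ (b ^ p - a ^ p) / p - 2 * t * ((b ^ (p-1) - a ^ (p-1)) / (p-1))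
      + t ^ 2 * ((b ^ (p-2) - a ^ (p-2)) / (p-2)) := by
    intro t
    have h : MonotoneOn (fun s : ℝ => (s ^ p / p - (2 * t) * (s ^ (p-1) / (p-1)))
        + t ^ 2 * (s ^ (p-2) / (p-2))) (Set.Icc a b) := by
      have hd : ∀ s ∈ interior (Set.Icc a b), HasDerivAt
          (fun s : ℝ => (s ^ p / p - (2 * t) * (s ^ (p-1) / (p-1)))
            + t ^ 2 * (s ^ (p-2) / (p-2))) (s ^ (p-3) * (s - t) ^ 2) s := by
        intro s hs
        rw [interior_Icc] at hs
        have h0 : 0 < s := ha.trans_lt hs.1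
        have e := (g_deriv (c := 2 * t) hp' h0).add
          (((Real.hasDerivAt_rpow_const (x := s) (p := p-2) (Or.inl h0.ne')).div_const
            (p-2)).const_mul (t^2))
        refine e.congr_deriv ?_
        have e1 : s ^ (p-2) = s ^ (p-3) * s := by
          rw [← Real.rpow_add_one h0.ne']; ring_nf
        have e2 : p - 2 - 1 = p - 3 := by ring
        rw [e2, e1]
        field_simp
        ring
      apply monotoneOn_of_deriv_nonneg (convex_Icc a b)
      · exact (g_cont hp' _).add (((Real.continuous_rpow_const (q := p - 2)
          (by linarith)).div_const _).const_mul _).continuousOn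
      · intro s hs
        exact (hd s hs).differentiableAt.differentiableWithinAt
      · intro s hs
        rw [(hd s hs).deriv]
        rw [interior_Icc] at hs
        have h0 : 0 < s := ha.trans_lt hs.1
        positivity
    have := h (Set.left_mem_Icc.2 hab.le) (Set.right_mem_Icc.2 hab.le) hab.le
    simp only at this
    rw [sub_div, sub_div, sub_div]
    linarith
  have hT : tt p a b * ((b ^ (p-1) - a ^ (p-1)) / (p-1)) = (b ^ p - a ^ p) / p := by
    rw [tt]; exact div_mul_cancel₀ _ hM.ne'
  rw [al, be, ← add_div, div_le_one hM]
  have hA : (b ^ (p-1) - a ^ (p-1)) = (p-1) * ((b ^ (p-1) - a ^ (p-1)) / (p-1)) := by field_simp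
  have hB : (b ^ (p-2) - a ^ (p-2)) = (p-2) * ((b ^ (p-2) - a ^ (p-2)) / (p-2)) := by field_simp
  set M := (b ^ (p-1) - a ^ (p-1)) / (p-1)
  set K := (b ^ (p-2) - a ^ (p-2)) / (p-2)
  have hcs : M ≤ tt p a b * K := by
    have := hq (M / K)
    rw [← hT] at this
    have e : tt p a b * M - 2 * (M / K) * M + (M / K) ^ 2 * K = (M / K) * (tt p a b * K - M) := by
      field_simp; ring
    rw [e] at this
    have := nonneg_of_mul_nonneg_right this (div_pos hM hK)
    linarith
  nlinarith [mul_le_mul_of_nonneg_left hcs (show 0 ≤ p - 2 by linarith)]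

lemma AB {p a b : ℝ} (hp : 1 < p) (ha : 0 ≤ a) (hab : a < b) :
    (a ^ p + (p-1) * b ^ p - p * a * b ^ (p-1)) / (b ^ (p-1) - a ^ (p-1)) = p * (tt p a b - a) ∧
    (b ^ p + (p-1) * a ^ p - p * b * a ^ (p-1)) / (b ^ (p-1) - a ^ (p-1)) = p * (b - tt p a b) := by
  have h3 := rp0 hp ha
  have h4 := rp0 hp (ha.trans hab.le)
  have hp0 : p ≠ 0 := by linarith
  have hp1 : p - 1 ≠ 0 := by linarith
  have hlt := Real.rpow_lt_rpow ha hab (show 0 < p - 1 by linarith)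
  have hd : b ^ (p-1) - a ^ (p-1) ≠ 0 := by linarith
  have hT2 : p * tt p a b * (b ^ (p-1) - a ^ (p-1)) = (p-1) * (b ^ p - a ^ p) := by
    rw [tt]; field_simp
  constructor
  · rw [div_eq_iff hd]
    linear_combination -hT2 - p * h3
  · rw [div_eq_iff hd]
    linear_combination hT2 - p * h4

/-- Monotone-matrix lemma. -/
lemma mono_aux {m : ℕ} (J : Matrix (Fin m) (Fin m) ℝ) (v : Fin m → ℝ) (hv : ∀ i, 0 < v i)
    (hoff : ∀ i j, i ≠ j → J i j ≤ 0)
    (hsup : ∀ i j : Fin m, (j : ℕ) = i + 1 → J i j < 0)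
    (hJv : ∀ i, 0 ≤ J.mulVec v i)
    (hlast : ∀ i : Fin m, (i : ℕ) + 1 = m → 0 < J.mulVec v i)
    (y : Fin m → ℝ) (hy : ∀ i, 0 ≤ J.mulVec y i) : ∀ i, 0 ≤ y i := by
  by_contra! hcon
  obtain ⟨i0, hi0⟩ := hcon
  obtain ⟨k, -, hk⟩ := Finset.exists_min_image Finset.univ (fun i => y i / v i) ⟨i0, Finset.mem_univ _⟩
  set c := y k / v k with hc
  have hcneg : c < 0 := (hk i0 (Finset.mem_univ _)).trans_lt (div_neg_of_neg_of_pos hi0 (hv _))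
  have hz : ∀ i, 0 ≤ y i - c * v i := by
    intro i
    have := (le_div_iff₀ (hv i)).1 (hk i (Finset.mem_univ _))
    linarith
  have hJz : ∀ i, J.mulVec y i = J.mulVec (fun j => y j - c * v j) i + c * J.mulVec v i := by
    intro i
    simp only [Matrix.mulVec, dotProduct, Finset.mul_sum, ← Finset.sum_add_distrib]
    apply Finset.sum_congr rfl; intros; ring
  have step : ∀ i : Fin m, y i - c * v i = 0 → (i : ℕ) + 1 ≠ m ∧
      ∀ j : Fin m, (j : ℕ) = i + 1 → y j - c * v j = 0 := by
    intro i hi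
    have hterm : ∀ j, J i j * (y j - c * v j) ≤ 0 := by
      intro j
      by_cases h : i = j
      · subst h; rw [hi]; simp
      · exact mul_nonpos_of_nonpos_of_nonneg (hoff i j h) (hz j)
    have hs : J.mulVec (fun j => y j - c * v j) i ≤ 0 := by
      have : J.mulVec (fun j => y j - c * v j) i = ∑ j, J i j * (y j - c * v j) := rfl
      rw [this]
      exact Finset.sum_nonpos fun j _ => hterm j
    have h1 := hJz i
    have h2 := hy i
    constructor
    · intro h
      nlinarith [mul_neg_of_neg_of_pos hcneg (hlast i h)]
    · intro j hj
      have h3 : J.mulVec (fun j => y j - c * v j) i ≤ J i j * (y j - c * v j) := by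
        have : J.mulVec (fun j => y j - c * v j) i = ∑ j, J i j * (y j - c * v j) := rfl
        rw [this, ← Finset.add_sum_erase _ _ (Finset.mem_univ j)]
        have := Finset.sum_nonpos (s := Finset.univ.erase j) fun j _ => hterm j
        linarith
      have h4 : c * J.mulVec v i ≤ 0 := mul_nonpos_of_nonpos_of_nonneg hcneg.le (hJv i)
      have h5 : J i j * (y j - c * v j) = 0 := le_antisymm (hterm j) (by linarith)
      rcases mul_eq_zero.1 h5 with h | h
      · exact absurd h (hsup i j hj).ne
      · exact h
  have hall : ∀ d : ℕ, ∀ h : (k : ℕ) + d < m, y ⟨k + d, h⟩ - c * v ⟨k + d, h⟩ = 0 := by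
    intro d
    induction d with
    | zero => intro h; have := (hv k).ne'; simp only [hc, Nat.add_zero, Fin.eta]; field_simp; ring
    | succ d ih =>
      intro h
      exact (step ⟨k + d, by omega⟩ (ih (by omega))).2 _ (by simp; omega)
  have hkm := k.2
  refine (step ⟨k + (m - 1 - k), by omega⟩ (hall _ (by omega))).1 ?_
  simp only; omega

lemma mono_inv {m : ℕ} (J : Matrix (Fin m) (Fin m) ℝ)
    (h : ∀ y : Fin m → ℝ, (∀ i, 0 ≤ J.mulVec y i) → ∀ i, 0 ≤ y i) :
    IsUnit J ∧ ∀ i j, 0 ≤ J⁻¹ i j := by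
  have hU : IsUnit J := by
    rw [← Matrix.mulVec_injective_iff_isUnit]
    intro a b hab
    have hab : J.mulVec a = J.mulVec b := hab
    have h1 := h (a - b) (by intro i; rw [Matrix.mulVec_sub, hab]; simp)
    have h2 := h (b - a) (by intro i; rw [Matrix.mulVec_sub, hab]; simp)
    funext i
    have := h1 i
    have := h2 i
    simp only [Pi.sub_apply] at *
    linarith
  refine ⟨hU, fun i j => ?_⟩
  refine h (fun i => J⁻¹ i j) ?_ i
  intro k
  have : J.mulVec (fun i => J⁻¹ i j) k = (J * J⁻¹) k j := rfl
  rw [this, Matrix.mul_nonsing_inv _ ((Matrix.isUnit_iff_isUnit_det _).1 hU), Matrix.one_apply]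
  split_ifs <;> norm_num

/-- Derivative of the `k`-th point. -/
noncomputable def DD (n k : ℕ) : (Fin (n - 1) → ℝ) →L[ℝ] ℝ :=
  if h : 0 < k ∧ k < n then ContinuousLinearMap.proj (R := ℝ) (φ := fun _ : Fin (n-1) => ℝ)
    (⟨k - 1, by omega⟩ : Fin (n-1)) else 0

lemma xi_deriv (l u : ℝ) (n k : ℕ) (x : Fin (n - 1) → ℝ) :
    HasFDerivAt (fun y => xiSeq l u n y k) (DD n k) x := by
  unfold xiSeq DD
  split_ifs with h
  · exact (ContinuousLinearMap.proj (R := ℝ) (φ := fun _ : Fin (n-1) => ℝ)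
      (⟨k - 1, by omega⟩ : Fin (n-1))).hasFDerivAt
  · exact hasFDerivAt_const _ _
  · exact hasFDerivAt_const _ _

lemma xi_ge {l u : ℝ} {n : ℕ} {x : Fin (n - 1) → ℝ} (hx : x ∈ domD l u n) :
    ∀ k ≤ n, l ≤ xiSeq l u n x k ∧ (0 < k → l < xiSeq l u n x k) := by
  intro k
  induction k with
  | zero => intro _; simp [xiSeq]
  | succ k ih =>
    intro hk
    have := (ih (by omega)).1
    have := hx k (by omega)
    exact ⟨by linarith, fun _ => by linarith⟩

lemma pow_deriv {l u : ℝ} (hl : 0 ≤ l) {n : ℕ} {x : Fin (n - 1) → ℝ} (hx : x ∈ domD l u n)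
    {k : ℕ} (hk : k ≤ n) (r : ℝ) :
    HasFDerivAt (fun y => xiSeq l u n y k ^ r) ((r * xiSeq l u n x k ^ (r-1)) • DD n k) x := by
  rcases Nat.eq_zero_or_pos k with rfl | h
  · have : DD n 0 = 0 := by simp [DD]
    rw [this, smul_zero]
    simp only [xiSeq]
    simpa using hasFDerivAt_const _ _
  · have h0 : 0 < xiSeq l u n x k := hl.trans_lt ((xi_ge hx k hk).2 h)
    exact (xi_deriv l u n k x).rpow_const (Or.inl h0.ne')

lemma tt_deriv {l u p : ℝ} (hl : 0 ≤ l) (hp : 1 < p) {n : ℕ} {x : Fin (n - 1) → ℝ}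
    (hx : x ∈ domD l u n) {k : ℕ} (hk : k < n) :
    HasFDerivAt (fun y => tt p (xiSeq l u n y k) (xiSeq l u n y (k+1)))
      (al p (xiSeq l u n x k) (xiSeq l u n x (k+1)) • DD n k +
        be p (xiSeq l u n x k) (xiSeq l u n x (k+1)) • DD n (k+1)) x := by
  have ha : 0 ≤ xiSeq l u n x k := hl.trans (xi_ge hx k hk.le).1
  have hab := hx k hk
  have hM := M0_pos hp ha hab
  have hN := (((pow_deriv hl hx (show k+1 ≤ n by omega) p).sub
    (pow_deriv hl hx hk.le p)).mul_const (p⁻¹))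
  have hD := (((pow_deriv hl hx (show k+1 ≤ n by omega) (p-1)).sub
    (pow_deriv hl hx hk.le (p-1))).mul_const ((p-1)⁻¹))
  have hQ := hN.mul ((hasDerivAt_inv (by have := hM.ne'; rw [div_eq_mul_inv] at this; exact this)).comp_hasFDerivAt x hD)
  have hp0 : p ≠ 0 := by linarith
  have hp1 : p - 1 ≠ 0 := by linarith
  refine (HasFDerivAt.congr_of_eventuallyEq hQ ?_).congr_fderiv ?_
  · refine Filter.Eventually.of_forall fun y => ?_
    simp [tt, div_eq_mul_inv]
  · ext w
    have h1 := rp1 hp ha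
    have h2 := rp1 hp (ha.trans hab.le)
    have e2 : p - 1 - 1 = p - 2 := by ring
    have hlt := Real.rpow_lt_rpow ha hab (show 0 < p - 1 by linarith)
    simp only [e2, al, be, tt]
    simp
    generalize xiSeq l u n x k = a at *
    generalize xiSeq l u n x (k+1) = b at *
    generalize DD n k w = d1
    generalize DD n (k+1) w = d2
    have hd : b ^ (p-1) - a ^ (p-1) ≠ 0 := by linarith
    have h3 := rp0 hp ha
    have h4 := rp0 hp (ha.trans hab.le)
    rw [← h3, ← h4, ← h1, ← h2]
    rw [← h1, ← h2] at hd
    field_simp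
    ring

lemma F_eq {l u p : ℝ} (hl : 0 ≤ l) (hp : 1 < p) {n : ℕ} {x : Fin (n - 1) → ℝ}
    (hx : x ∈ domD l u n) (i : Fin (n-1)) :
    Fmap l u p n x i = p * (2 * xiSeq l u n x (i+1) - tt p (xiSeq l u n x i) (xiSeq l u n x (i+1))
      - tt p (xiSeq l u n x (i+1)) (xiSeq l u n x (i+1+1))) := by
  have hi := i.2
  have h1 := (AB hp (hl.trans (xi_ge hx i (by omega)).1) (hx i (by omega))).2
  have h2 := (AB hp (hl.trans (xi_ge hx (i+1) (by omega)).1) (hx (i+1) (by omega))).1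
  unfold Fmap
  rw [h1, neg_div, h2]
  ring

lemma dom_ev {l u : ℝ} {n : ℕ} {x : Fin (n - 1) → ℝ} (hx : x ∈ domD l u n) :
    ∀ᶠ y in nhds x, y ∈ domD l u n := by
  have : ∀ᶠ y in nhds x, ∀ i ∈ Finset.range n, xiSeq l u n y i < xiSeq l u n y (i+1) := by
    rw [Filter.eventually_all_finset]
    intro i hi
    exact (xi_deriv l u n i x).continuousAt.eventually_lt (xi_deriv l u n (i+1) x).continuousAt
      (hx i (Finset.mem_range.1 hi))
  filter_upwards [this] with y hy i hi
  exact hy i (Finset.mem_range.2 hi)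

lemma F_deriv {l u p : ℝ} (hl : 0 ≤ l) (hp : 1 < p) {n : ℕ} {x : Fin (n - 1) → ℝ}
    (hx : x ∈ domD l u n) (i : Fin (n-1)) (w : Fin (n-1) → ℝ) :
    fderiv ℝ (fun y => Fmap l u p n y i) x w =
      p * (2 * DD n (i+1) w - (al p (xiSeq l u n x i) (xiSeq l u n x (i+1)) * DD n i w +
        be p (xiSeq l u n x i) (xiSeq l u n x (i+1)) * DD n (i+1) w)
        - (al p (xiSeq l u n x (i+1)) (xiSeq l u n x (i+1+1)) * DD n (i+1) w +
        be p (xiSeq l u n x (i+1)) (xiSeq l u n x (i+1+1)) * DD n (i+1+1) w)) := by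
  have hi := i.2
  have h := ((((xi_deriv l u n (i+1) x).const_mul 2).sub
    (tt_deriv hl hp hx (show (i:ℕ) < n by omega))).sub
    (tt_deriv hl hp hx (show (i:ℕ) + 1 < n by omega))).const_mul p
  have h2 := h.congr_of_eventuallyEq (f₁ := fun y => Fmap l u p n y i)
    (by filter_upwards [dom_ev hx] with y hy using F_eq hl hp hy i)
  rw [h2.fderiv]
  simp

lemma J_mulVec (l u p : ℝ) (n : ℕ) (x w : Fin (n - 1) → ℝ) (i : Fin (n-1)) :
    (Jmat l u p n x).mulVec w i = fderiv ℝ (fun y => Fmap l u p n y i) x w := by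
  conv_rhs => rw [pi_eq_sum_univ' w, map_sum]
  simp only [map_smul, smul_eq_mul, Matrix.mulVec, dotProduct, Jmat, Matrix.of_apply]
  apply Finset.sum_congr rfl
  intro j _
  rw [mul_comm]

lemma DD_single (n k : ℕ) (j : Fin (n-1)) :
    DD n k (Pi.single j 1) = if k = j + 1 then 1 else 0 := by
  have hj := j.2
  unfold DD
  split_ifs with h h2 h2
  · subst h2; simp
  · simp only [ContinuousLinearMap.proj_apply, Pi.single_apply, Fin.ext_iff]
    rw [if_neg (by omega)]
  · omega
  · rfl

/-- If either `1 < p < 2` and `F(ξ) ≥ 0`, or `p > 2`, then the Jacobian `J(ξ)` is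
invertible and its inverse has nonnegative entries. -/
theorem Jacobian_inverse_nonneg
    (l u : ℝ) (hl : 0 ≤ l) (hlu : l < u) (n : ℕ) (hn : 2 ≤ n) (p : ℝ) (hp : 1 < p)
    (x : Fin (n - 1) → ℝ) (hx : x ∈ domD l u n)
    (hcase : (p < 2 ∧ ∀ i, 0 ≤ Fmap l u p n x i) ∨ 2 < p) :
    IsUnit (Jmat l u p n x) ∧ ∀ i j, 0 ≤ (Jmat l u p n x)⁻¹ i j := by
  have hp0 : 0 < p := by linarith
  have hal : ∀ k < n, 0 ≤ al p (xiSeq l u n x k) (xiSeq l u n x (k+1)) := fun k hk =>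
    al_nonneg hp (hl.trans (xi_ge hx k hk.le).1) (hx k hk)
  have hbe : ∀ k < n, 0 < be p (xiSeq l u n x k) (xiSeq l u n x (k+1)) := fun k hk =>
    be_pos hp (hl.trans (xi_ge hx k hk.le).1) (hx k hk)
  have key : ∀ i j : Fin (n-1), Jmat l u p n x i j = p *
      (2 * (if (i:ℕ) + 1 = j + 1 then 1 else 0) -
        (al p (xiSeq l u n x i) (xiSeq l u n x (i+1)) * (if (i:ℕ) = j + 1 then 1 else 0) +
        be p (xiSeq l u n x i) (xiSeq l u n x (i+1)) * (if (i:ℕ) + 1 = j + 1 then 1 else 0))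
        - (al p (xiSeq l u n x (i+1)) (xiSeq l u n x (i+1+1)) *
            (if (i:ℕ) + 1 = j + 1 then 1 else 0) +
        be p (xiSeq l u n x (i+1)) (xiSeq l u n x (i+1+1)) *
            (if (i:ℕ) + 1 + 1 = j + 1 then 1 else 0))) := by
    intro i j
    simp only [← DD_single]
    exact F_deriv hl hp hx i _
  have hoff : ∀ i j, i ≠ j → Jmat l u p n x i j ≤ 0 := by
    intro i j hij
    have hi := i.2
    have hij' : ¬ ((i:ℕ) + 1 = j + 1) := fun h => hij (Fin.ext (by omega))
    rw [key, if_neg hij']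
    have h1 := hal i (by omega)
    have h2 := hbe (i+1) (by omega)
    apply mul_nonpos_of_nonneg_of_nonpos hp0.le
    split_ifs <;> linarith
  have hsup : ∀ i j : Fin (n-1), (j : ℕ) = i + 1 → Jmat l u p n x i j < 0 := by
    intro i j hij
    have hi := i.2
    rw [key, if_neg (by omega), if_neg (by omega), if_pos (by omega)]
    have h2 := hbe (i+1) (by omega)
    apply mul_neg_of_pos_of_neg hp0
    linarith
  -- a test vector dominated by an extended sequence
  have main : ∀ (v : Fin (n-1) → ℝ) (V : ℕ → ℝ), (∀ i, 0 < v i) → (∀ k, 0 ≤ V k) → 0 < V n →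
      (∀ i : Fin (n-1), v i = V (i+1)) →
      (∀ i : Fin (n-1), 0 ≤ 2 * V (i+1) - (al p (xiSeq l u n x i) (xiSeq l u n x (i+1)) * V i +
        be p (xiSeq l u n x i) (xiSeq l u n x (i+1)) * V (i+1))
        - (al p (xiSeq l u n x (i+1)) (xiSeq l u n x (i+1+1)) * V (i+1) +
        be p (xiSeq l u n x (i+1)) (xiSeq l u n x (i+1+1)) * V (i+1+1))) →
      IsUnit (Jmat l u p n x) ∧ ∀ i j, 0 ≤ (Jmat l u p n x)⁻¹ i j := by
    intro v V hv hV hVn hvV hineq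
    have hDle : ∀ k, DD n k v ≤ V k := by
      intro k
      unfold DD
      split_ifs with h
      · simp only [ContinuousLinearMap.proj_apply, hvV]
        rw [Nat.sub_add_cancel h.1]
      · exact hV k
    have hDn : DD n n v = 0 := by simp [DD]
    have hDi : ∀ i : Fin (n-1), DD n (i+1) v = V (i+1) := by
      intro i
      have hi := i.2
      unfold DD
      rw [dif_pos (by omega)]
      simp [hvV]
    apply mono_inv
    apply mono_aux _ v hv hoff hsup
    · intro i
      have hi := i.2
      rw [J_mulVec, F_deriv hl hp hx]
      apply mul_nonneg hp0.le
      have h1 := mul_le_mul_of_nonneg_left (hDle i) (hal i (by omega))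
      have h2 := mul_le_mul_of_nonneg_left (hDle (i+1+1)) (hbe (i+1) (by omega)).le
      rw [hDi]
      linarith [hineq i]
    · intro i hin
      have hi := i.2
      rw [J_mulVec, F_deriv hl hp hx]
      apply mul_pos hp0
      have h1 := mul_le_mul_of_nonneg_left (hDle i) (hal i (by omega))
      have e : (i:ℕ) + 1 + 1 = n := by omega
      have h2 := mul_pos (hbe (i+1) (by omega)) hVn
      have h3 := hineq i
      rw [hDi]
      rw [e] at h2 h3 ⊢
      rw [hDn]
      linarith
  rcases hcase with ⟨-, hF⟩ | hp2
  · have hu : 0 < u := by linarith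
    have hxi : ∀ i : Fin (n-1), x i = xiSeq l u n x (i+1) := by
      intro i
      have hi := i.2
      unfold xiSeq
      rw [dif_pos (by omega)]
      simp
    have hxp : ∀ i, 0 < x i := by
      intro i
      have hi := i.2
      rw [hxi]
      exact hl.trans_lt ((xi_ge hx _ (by omega)).2 (by omega))
    refine main x (xiSeq l u n x) hxp ?_ ?_ hxi ?_
    · intro k
      unfold xiSeq
      split_ifs
      · exact (hxp _).le
      · exact hl
      · exact hu.le
    · exact hl.trans_lt ((xi_ge hx _ le_rfl).2 (by omega))
    · intro i
      have hi := i.2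
      have h1 := euler hp (hl.trans (xi_ge hx i (by omega)).1) (hx i (by omega))
      have h2 := euler hp (hl.trans (xi_ge hx (i+1) (by omega)).1) (hx (i+1) (by omega))
      have h3 := hF i
      rw [F_eq hl hp hx] at h3
      have := nonneg_of_mul_nonneg_right h3 hp0
      linarith
  · refine main (fun _ => 1) (fun _ => 1) (by simp) (by simp) (by simp) (by simp) ?_
    intro i
    have hi := i.2
    have h1 := sum_le_one hp2 (hl.trans (xi_ge hx i (by omega)).1) (hx i (by omega))
    have h2 := sum_le_one hp2 (hl.trans (xi_ge hx (i+1) (by omega)).1) (hx (i+1) (by omega))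
    linarith
end

section
/- Let p > 1 and define, on the open convex set Ω := {(a, b, c) ∈ ℝ³ : 0 < a < b < c}, the function G(a, b, c) := −(b^p + (p−1)c^p − p·b·c^{p−1})/(c^{p−1} − b^{p−1}) + (b^p + (p−1)a^p − p·b·a^{p−1})/(b^{p−1} − a^{p−1}). Then: (i) if 1 < p < 2, G is convex on Ω; (ii) if p > 2, G is concave on Ω. -/
/-- The component of the stationarity map, as a function of a triple
`(a, b, c)` with `0 < a < b < c`:
`G(a,b,c) = −(bᵖ + (p−1)cᵖ − p·b·c^{p−1})/(c^{p−1} − b^{p−1})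
           + (bᵖ + (p−1)aᵖ − p·b·a^{p−1})/(b^{p−1} − a^{p−1})`. -/
noncomputable def Gmap (p : ℝ) (v : ℝ × ℝ × ℝ) : ℝ :=
  -(v.2.1 ^ p + (p - 1) * v.2.2 ^ p - p * v.2.1 * v.2.2 ^ (p - 1))
      / (v.2.2 ^ (p - 1) - v.2.1 ^ (p - 1))
  + (v.2.1 ^ p + (p - 1) * v.1 ^ p - p * v.2.1 * v.1 ^ (p - 1))
      / (v.2.1 ^ (p - 1) - v.1 ^ (p - 1))

/-- The open convex domain `Ω = {(a,b,c) : 0 < a < b < c}`. -/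
def OmegaSet : Set (ℝ × ℝ × ℝ) := {v | 0 < v.1 ∧ v.1 < v.2.1 ∧ v.2.1 < v.2.2}

/-- The auxiliary one-variable function. -/
noncomputable def gAux (q t : ℝ) : ℝ := (t - 1) / (t ^ q - 1)

lemma bern_eq (q t : ℝ) (ht : 1 < t) :
    (q - 1) * t ^ q - q * t ^ (q - 1) + 1 = t ^ q * ((t⁻¹) ^ q - (1 + q * (t⁻¹ - 1))) := by
  have h0 : 0 < t := by linarith
  have h1 : 0 < t ^ q := Real.rpow_pos_of_pos h0 q
  rw [Real.rpow_sub_one h0.ne', Real.inv_rpow h0.le]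
  field_simp
  ring

lemma bern_ge (q t : ℝ) (hq : 1 < q) (ht : 1 < t) :
    0 ≤ (q - 1) * t ^ q - q * t ^ (q - 1) + 1 := by
  have h0 : 0 < t := by linarith
  have h1 : 0 < t ^ q := Real.rpow_pos_of_pos h0 q
  have h2 : 0 < t⁻¹ := by positivity
  rw [bern_eq q t ht]
  have := one_add_mul_self_le_rpow_one_add (s := t⁻¹ - 1) (by linarith) hq.le
  rw [add_sub_cancel] at this
  exact mul_nonneg h1.le (by linarith)

lemma bern_le (q t : ℝ) (hq0 : 0 < q) (hq : q < 1) (ht : 1 < t) :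
    (q - 1) * t ^ q - q * t ^ (q - 1) + 1 ≤ 0 := by
  have h0 : 0 < t := by linarith
  have h1 : 0 < t ^ q := Real.rpow_pos_of_pos h0 q
  have h2 : 0 < t⁻¹ := by positivity
  rw [bern_eq q t ht]
  have := rpow_one_add_le_one_add_mul_self (s := t⁻¹ - 1) (by linarith) hq0.le hq.le
  rw [add_sub_cancel] at this
  exact mul_nonpos_of_nonneg_of_nonpos h1.le (by linarith)

lemma B_nonneg (q e : ℝ) (hq : 0 < q)
    (H : ∀ t : ℝ, 1 < t → 0 ≤ e * ((q - 1) * t ^ q - q * t ^ (q - 1) + 1)) (t : ℝ) (ht : 1 < t) :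
    0 ≤ e * ((q - 1) * (t ^ (q + 1) - 1) - (q + 1) * (t ^ q - t)) := by
  have hd : ∀ x : ℝ, 1 ≤ x → HasDerivAt
      (fun t : ℝ => e * ((q - 1) * (t ^ (q + 1) - 1) - (q + 1) * (t ^ q - t)))
      ((q + 1) * (e * ((q - 1) * x ^ q - q * x ^ (q - 1) + 1))) x := by
    intro x hx
    have hx0 : x ≠ 0 := by linarith
    have h1 := Real.hasDerivAt_rpow_const (p := q + 1) (Or.inl hx0)
    have h2 := Real.hasDerivAt_rpow_const (p := q) (Or.inl hx0)
    have h3 := ((((h1.sub_const 1).const_mul (q - 1)).sub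
      ((h2.sub (hasDerivAt_id x)).const_mul (q + 1))).const_mul e)
    refine HasDerivAt.congr_deriv h3 ?_
    rw [add_sub_cancel_right]
    ring
  have hm : MonotoneOn
      (fun t : ℝ => e * ((q - 1) * (t ^ (q + 1) - 1) - (q + 1) * (t ^ q - t))) (Set.Ici 1) := by
    apply monotoneOn_of_deriv_nonneg (convex_Ici 1)
    · intro x hx
      exact (hd x hx).continuousAt.continuousWithinAt
    · intro x hx
      rw [interior_Ici] at hx
      exact (hd x (le_of_lt hx)).differentiableAt.differentiableWithinAt
    · intro x hx
      rw [interior_Ici] at hx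
      rw [(hd x (le_of_lt hx)).deriv]
      exact mul_nonneg (by linarith) (H x hx)
  have := hm (Set.mem_Ici.2 le_rfl) (Set.mem_Ici.2 ht.le) ht.le
  simpa using this

lemma gAux_convex (q e : ℝ) (hq : 0 < q)
    (H : ∀ t : ℝ, 1 < t → 0 ≤ e * ((q - 1) * t ^ q - q * t ^ (q - 1) + 1)) :
    ConvexOn ℝ (Set.Ioi 1) (fun t => e * gAux q t) := by
  have hD : ∀ x : ℝ, 1 < x → 0 < x ^ q - 1 := fun x hx => by
    have := Real.one_lt_rpow hx hq
    linarith
  have hd1 : ∀ x : ℝ, 1 < x → HasDerivAt (fun t => e * gAux q t)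
      (e * ((x ^ q - 1 - (x - 1) * (q * x ^ (q - 1))) / (x ^ q - 1) ^ 2)) x := by
    intro x hx
    have hx0 : x ≠ 0 := by linarith
    have h2 := Real.hasDerivAt_rpow_const (p := q) (Or.inl hx0)
    have h3 := ((((hasDerivAt_id x).sub_const 1).div (h2.sub_const 1) (hD x hx).ne').const_mul e)
    refine HasDerivAt.congr_deriv h3 ?_
    simp
  have hd2 : ∀ x : ℝ, 1 < x → HasDerivAt
      (fun x => e * ((x ^ q - 1 - (x - 1) * (q * x ^ (q - 1))) / (x ^ q - 1) ^ 2))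
      (q * x ^ (q - 2) / (x ^ q - 1) ^ 3 *
        (e * ((q - 1) * (x ^ (q + 1) - 1) - (q + 1) * (x ^ q - x)))) x := by
    intro x hx
    have hx0 : x ≠ 0 := by linarith
    have hxp : 0 < x := by linarith
    have h2 := Real.hasDerivAt_rpow_const (p := q) (Or.inl hx0)
    have h1 := Real.hasDerivAt_rpow_const (p := q - 1) (Or.inl hx0)
    have hDx := (hD x hx).ne'
    have h3 := (((h2.sub_const 1).sub (((hasDerivAt_id x).sub_const 1).mul
      (h1.const_mul q))).div ((h2.sub_const 1).pow 2) (pow_ne_zero 2 hDx)).const_mul e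
    refine HasDerivAt.congr_deriv h3 ?_
    simp only [Pi.sub_apply, Pi.mul_apply, Pi.pow_apply, id]
    have e1 : x ^ (q - 1) = x ^ (q - 2) * x := by
      rw [← Real.rpow_add_one hx0]; congr 1; ring
    have e2 : x ^ q = x ^ (q - 2) * x * x := by
      rw [← e1, ← Real.rpow_add_one hx0]; congr 1; ring
    have e3 : x ^ (q + 1) = x ^ (q - 2) * x * x * x := by
      rw [Real.rpow_add_one hx0, e2]
    have e4 : q - 1 - 1 = q - 2 := by ring
    rw [e4, e3, e1]
    rw [e2] at hDx ⊢
    generalize x ^ (q - 2) = w at *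
    have hDx' : w * x ^ 2 - 1 ≠ 0 := by
      intro h
      apply hDx
      linarith
    rw [show w * x * x = w * x ^ 2 by ring]
    push_cast
    field_simp
    ring
  apply convexOn_of_hasDerivWithinAt2_nonneg (convex_Ioi 1)
    (f' := fun x => e * ((x ^ q - 1 - (x - 1) * (q * x ^ (q - 1))) / (x ^ q - 1) ^ 2))
    (f'' := fun x => q * x ^ (q - 2) / (x ^ q - 1) ^ 3 *
        (e * ((q - 1) * (x ^ (q + 1) - 1) - (q + 1) * (x ^ q - x))))
  · intro x hx
    exact (hd1 x hx).continuousAt.continuousWithinAt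
  · intro x hx
    rw [interior_Ioi] at hx
    exact (hd1 x hx).hasDerivWithinAt
  · intro x hx
    rw [interior_Ioi] at hx
    exact (hd2 x hx).hasDerivWithinAt
  · intro x hx
    rw [interior_Ioi] at hx
    have hx' : (1 : ℝ) < x := hx
    have := hD x hx
    have h0 : 0 < x ^ (q - 2) := Real.rpow_pos_of_pos (by linarith) _
    exact mul_nonneg (by positivity) (B_nonneg q e hq H x hx)

lemma persp (φ : ℝ → ℝ) (h : ConvexOn ℝ (Set.Ioi 1) φ) (x1 y1 x2 y2 α β : ℝ)
    (hx1 : 0 < x1) (h1 : x1 < y1) (hx2 : 0 < x2) (h2 : x2 < y2)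
    (hα : 0 ≤ α) (hβ : 0 ≤ β) (hs : α + β = 1) :
    (α * x1 + β * x2) * φ ((α * y1 + β * y2) / (α * x1 + β * x2)) ≤
      α * (x1 * φ (y1 / x1)) + β * (x2 * φ (y2 / x2)) := by
  have hX : 0 < α * x1 + β * x2 := by
    rcases hα.eq_or_lt with h0 | h0
    · have : β = 1 := by linarith
      subst this; rw [← h0]; linarith
    · have := mul_pos h0 hx1
      have := mul_nonneg hβ hx2.le
      linarith
  have key := h.2 (Set.mem_Ioi.2 ((one_lt_div hx1).2 h1)) (Set.mem_Ioi.2 ((one_lt_div hx2).2 h2))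
    (show 0 ≤ α * x1 / (α * x1 + β * x2) by positivity)
    (show 0 ≤ β * x2 / (α * x1 + β * x2) by positivity) (by field_simp)
  simp only [smul_eq_mul] at key
  have e1 : α * x1 / (α * x1 + β * x2) * (y1 / x1) + β * x2 / (α * x1 + β * x2) * (y2 / x2)
      = (α * y1 + β * y2) / (α * x1 + β * x2) := by
    field_simp
  rw [e1] at key
  have := mul_le_mul_of_nonneg_left key hX.le
  refine this.trans (le_of_eq ?_)
  field_simp

lemma half_eq (p x y : ℝ) (hp : 1 < p) (hx : 0 < x) (hxy : x < y) :
    -(x ^ p + (p - 1) * y ^ p - p * x * y ^ (p - 1)) / (y ^ (p - 1) - x ^ (p - 1))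
      = p * x - (p - 1) * (y + x * gAux (p - 1) (y / x)) ∧
    (y ^ p + (p - 1) * x ^ p - p * y * x ^ (p - 1)) / (y ^ (p - 1) - x ^ (p - 1))
      = p * y - (p - 1) * (y + x * gAux (p - 1) (y / x)) := by
  have hy : 0 < y := hx.trans hxy
  have hlt := Real.rpow_lt_rpow hx.le hxy (by linarith : 0 < p - 1)
  have ex : x ^ p = x ^ (p - 1) * x := by
    rw [← Real.rpow_add_one hx.ne']; congr 1; ring
  have ey : y ^ p = y ^ (p - 1) * y := by
    rw [← Real.rpow_add_one hy.ne']; congr 1; ring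
  have hX : 0 < x ^ (p - 1) := Real.rpow_pos_of_pos hx _
  have hg : x * gAux (p - 1) (y / x)
      = (y - x) * x ^ (p - 1) / (y ^ (p - 1) - x ^ (p - 1)) := by
    unfold gAux
    rw [Real.div_rpow hy.le hx.le]
    generalize x ^ (p - 1) = X at *
    generalize y ^ (p - 1) = Y at *
    have hne : Y - X ≠ 0 := by linarith
    have : Y / X - 1 = (Y - X) / X := by field_simp
    rw [this]
    field_simp
  rw [hg, ex, ey]
  generalize x ^ (p - 1) = X at *
  generalize y ^ (p - 1) = Y at *
  have hne : Y - X ≠ 0 := by linarith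
  constructor
  · field_simp
    ring
  · field_simp
    ring

lemma G_eq (p : ℝ) (hp : 1 < p) (v : ℝ × ℝ × ℝ) (hv : v ∈ OmegaSet) :
    Gmap p v = 2 * p * v.2.1 - (p - 1) * (v.2.2 + v.2.1)
      - (p - 1) * (v.2.1 * gAux (p - 1) (v.2.2 / v.2.1))
      - (p - 1) * (v.1 * gAux (p - 1) (v.2.1 / v.1)) := by
  obtain ⟨h1, h2, h3⟩ := hv
  unfold Gmap
  rw [(half_eq p _ _ hp (h1.trans h2) h3).1, (half_eq p _ _ hp h1 h2).2]
  ring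

lemma omega_convex : Convex ℝ OmegaSet := by
  rintro ⟨a1, b1, c1⟩ ⟨h1, h2, h3⟩ ⟨a2, b2, c2⟩ ⟨k1, k2, k3⟩ α β hα hβ hs
  have key : ∀ s t : ℝ, 0 < s → 0 < t → 0 < α * s + β * t := by
    intro s t hs' ht'
    rcases hα.eq_or_lt with h0 | h0
    · have : β = 1 := by linarith
      subst this; rw [← h0]; linarith
    · have := mul_pos h0 hs'
      have := mul_nonneg hβ ht'.le
      linarith
  dsimp only at h1 h2 h3 k1 k2 k3
  refine ⟨?_, ?_, ?_⟩
  · simpa using key _ _ h1 k1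
  · have := key _ _ (sub_pos.2 h2) (sub_pos.2 k2)
    simp only [Prod.smul_mk, Prod.mk_add_mk, smul_eq_mul]
    linarith
  · have := key _ _ (sub_pos.2 h3) (sub_pos.2 k3)
    simp only [Prod.smul_mk, Prod.mk_add_mk, smul_eq_mul]
    linarith

lemma G_main (p e : ℝ) (hp : 1 < p)
    (H : ∀ t : ℝ, 1 < t →
      0 ≤ e * ((p - 1 - 1) * t ^ (p - 1) - (p - 1) * t ^ (p - 1 - 1) + 1))
    (u v : ℝ × ℝ × ℝ) (hu : u ∈ OmegaSet) (hv : v ∈ OmegaSet) (α β : ℝ)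
    (hα : 0 ≤ α) (hβ : 0 ≤ β) (hs : α + β = 1) :
    e * (α * Gmap p u + β * Gmap p v) ≤ e * Gmap p (α • u + β • v) := by
  have hc := gAux_convex (p - 1) e (by linarith) H
  rw [G_eq p hp u hu, G_eq p hp v hv, G_eq p hp _ (omega_convex hu hv hα hβ hs)]
  obtain ⟨a1, b1, c1⟩ := u
  obtain ⟨a2, b2, c2⟩ := v
  obtain ⟨h1, h2, h3⟩ := hu
  obtain ⟨k1, k2, k3⟩ := hv
  dsimp only at h1 h2 h3 k1 k2 k3
  simp only [Prod.smul_mk, Prod.mk_add_mk, smul_eq_mul]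
  have P1 := persp _ hc a1 b1 a2 b2 α β h1 h2 k1 k2 hα hβ hs
  have P2 := persp _ hc b1 c1 b2 c2 α β (h1.trans h2) h3 (k1.trans k2) k3 hα hβ hs
  have P3 := mul_le_mul_of_nonneg_left (add_le_add P1 P2) (by linarith : 0 ≤ p - 1)
  linarith

/-- `G` is convex on `Ω` for `1 < p < 2`, and concave on `Ω` for `p > 2`. -/
theorem Gmap_convex_concave (p : ℝ) (hp : 1 < p) :
    (p < 2 → ConvexOn ℝ OmegaSet (Gmap p)) ∧
    (2 < p → ConcaveOn ℝ OmegaSet (Gmap p)) := by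
  constructor
  · intro h2
    refine ⟨omega_convex, ?_⟩
    intro u hu v hv α β hα hβ hs
    have := G_main p (-1) hp (fun t ht => by
      have := bern_le (p - 1) t (by linarith) (by linarith) ht
      linarith) u v hu hv α β hα hβ hs
    simp only [smul_eq_mul]
    linarith
  · intro h2
    refine ⟨omega_convex, ?_⟩
    intro u hu v hv α β hα hβ hs
    have := G_main p 1 hp (fun t ht => by
      have := bern_ge (p - 1) t (by linarith) ht
      linarith) u v hu hv α β hα hβ hs
    simp only [smul_eq_mul]
    linarith
end
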